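/- Let p be a prime, t ≥ 1, n = p^t, and R a commutative ring with n = 0 in R (so R is a Z/nZ-algebra on which n vanishes). An R-module N is free as a Z/p^tZ-module if and only if Tor_1^R(N, R/(p)) = 0, where (p) is the principal ideal generated by p in R, provided R itself is free as a Z/p^tZ-module. -/

import Mathlib

open CategoryTheory

section homological
variable {R : Type} [CommRing R] (a b : R)

noncomputable def altMul (c : R) : ModuleCat.of R R ⟶ ModuleCat.of R R :=
  ModuleCat.ofHom (c • LinearMap.id)

lemma altMul_apply (c x : R) : (altMul c).hom x = c * x := rfl

lemma altMul_comp {c d : R} (h : c * d = 0) : altMul c ≫ altMul d = 0 := by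
  ext
  change d * (c * 1) = 0
  rw [mul_one, mul_comm, h]

noncomputable def altComplex (hab : a * b = 0) : ChainComplex (ModuleCat R) ℕ :=
  HomologicalComplex.alternatingConst (ModuleCat.of R R) (φ := altMul b) (ψ := altMul a)
    (altMul_comp (by rw [mul_comm, hab])) (altMul_comp hab)
    (fun _ _ => ComplexShape.down_nat_odd_add)

lemma altComplex_d_odd (hab : a * b = 0) (i : ℕ) (hi : ¬ Even (i + 1)) :
    (altComplex a b hab).d (i + 1) i = altMul a := by
  simp [altComplex, HomologicalComplex.alternatingConst, if_neg hi]

lemma altComplex_d_even (hab : a * b = 0) (i : ℕ) (hi : Even (i + 1)) :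
    (altComplex a b hab).d (i + 1) i = altMul b := by
  simp [altComplex, HomologicalComplex.alternatingConst, if_pos hi]

noncomputable def altAug : ModuleCat.of R R ⟶ ModuleCat.of R (R ⧸ Ideal.span {a}) :=
  ModuleCat.ofHom (Submodule.mkQ _)

lemma altAug_comp : altMul a ≫ altAug a = 0 := by
  ext
  change Submodule.Quotient.mk (a * 1) = (0 : R ⧸ Ideal.span {a})
  rw [(Submodule.Quotient.mk_eq_zero _)]
  · rw [mul_one]; exact Ideal.mem_span_singleton_self a

noncomputable def altπ (hab : a * b = 0) : altComplex a b hab ⟶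
    (ChainComplex.single₀ (ModuleCat R)).obj (ModuleCat.of R (R ⧸ Ideal.span {a})) :=
  ((altComplex a b hab).toSingle₀Equiv _).symm ⟨altAug a, by
    rw [altComplex_d_odd a b hab 0 (by decide)]
    exact altAug_comp a⟩

lemma altπ_quasiIso (hab : a * b = 0) (h1 : ∀ x : R, a * x = 0 → ∃ y, b * y = x)
    (h2 : ∀ x : R, b * x = 0 → ∃ y, a * y = x) : QuasiIso (altπ a b hab) where
  quasiIsoAt m := by
    induction m with
    | zero =>
      rw [ChainComplex.quasiIsoAt₀_iff, ShortComplex.quasiIso_iff_of_zeros' _ rfl rfl rfl]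
      constructor
      · rw [ShortComplex.moduleCat_exact_iff]
        intro (x : R) hx
        have hx' : (altAug a).hom x = 0 := by
          simpa [altπ, ChainComplex.toSingle₀Equiv] using! hx
        have hx'' : (x : R) ∈ Ideal.span {a} := (Submodule.Quotient.mk_eq_zero _).1 hx'
        obtain ⟨y, hy⟩ := Ideal.mem_span_singleton.1 hx''
        refine ⟨y, ?_⟩
        change ((altComplex a b hab).d 1 0).hom y = x
        rw [altComplex_d_odd a b hab 0 (by decide)]
        exact hy.symm
      · have : Epi (altAug a) := by
          rw [ModuleCat.epi_iff_surjective]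
          exact Submodule.mkQ_surjective _
        simpa [altπ, ChainComplex.toSingle₀Equiv] using! this
    | succ m _ =>
      rw [quasiIsoAt_iff_exactAt' (hL := ChainComplex.exactAt_succ_single_obj ..),
          HomologicalComplex.exactAt_iff' _ (m + 2) (m + 1) m (by simp) (by simp),
          ShortComplex.moduleCat_exact_iff]
      intro x hx
      change ((altComplex a b hab).d (m+1) m).hom x = 0 at hx
      change ∃ y, ((altComplex a b hab).d (m+1+1) (m+1)).hom y = x
      by_cases hm : Even (m + 1)
      · rw [altComplex_d_even a b hab _ hm] at hx
        rw [altComplex_d_odd a b hab _ (by simpa [Nat.even_add_one] using hm)]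
        exact h2 x hx
      · rw [altComplex_d_odd a b hab _ hm] at hx
        rw [altComplex_d_even a b hab _ (by simpa [Nat.even_add_one] using hm)]
        exact h1 x hx

noncomputable def altRes (hab : a * b = 0) (h1 : ∀ x : R, a * x = 0 → ∃ y, b * y = x)
    (h2 : ∀ x : R, b * x = 0 → ∃ y, a * y = x) :
    ProjectiveResolution (ModuleCat.of R (R ⧸ Ideal.span {a})) where
  complex := altComplex a b hab
  projective _ := inferInstanceAs (Projective (ModuleCat.of R R))
  π := altπ a b hab
  quasiIso := altπ_quasiIso a b hab h1 h2

lemma whisker_altMul (N : ModuleCat R) (c : R) (z : TensorProduct R N R) :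
    (((MonoidalCategory.tensoringLeft (ModuleCat R)).obj N).map (altMul c)).hom z = c • z := by
  have h1 : altMul c = c • 𝟙 (ModuleCat.of R R) := rfl
  have h2 : ((MonoidalCategory.tensoringLeft (ModuleCat R)).obj N).map (altMul c) =
      c • 𝟙 _ := by
    change MonoidalCategory.whiskerLeft N (altMul c) = _
    rw [h1, MonoidalLinear.whiskerLeft_smul,
      MonoidalCategory.whiskerLeft_id]
    rfl
  rw [h2]
  rfl

lemma tor_subsingleton_iff (hab : a * b = 0) (h1 : ∀ x : R, a * x = 0 → ∃ y, b * y = x)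
    (h2 : ∀ x : R, b * x = 0 → ∃ y, a * y = x) (N : Type) [AddCommGroup N] [Module R N] :
    Subsingleton (((Tor (ModuleCat R) 1).obj (ModuleCat.of R N)).obj
      (ModuleCat.of R (R ⧸ Ideal.span {a}))) ↔ ∀ x : N, a • x = 0 → ∃ y : N, b • y = x := by
  let F := (MonoidalCategory.tensoringLeft (ModuleCat R)).obj (ModuleCat.of R N)
  let P := altRes a b hab h1 h2
  have e := P.isoLeftDerivedObj F 1
  rw [← ModuleCat.isZero_iff_subsingleton]
  change Limits.IsZero ((F.leftDerived 1).obj _) ↔ _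
  rw [e.isZero_iff]
  change Limits.IsZero (HomologicalComplex.homology _ 1) ↔ _
  rw [← HomologicalComplex.exactAt_iff_isZero_homology,
    HomologicalComplex.exactAt_iff' _ 2 1 0 (by simp) (by simp),
    ShortComplex.moduleCat_exact_iff]
  change (∀ x : TensorProduct R N R, (F.map ((altComplex a b hab).d 1 0)).hom x = 0 →
    ∃ y : TensorProduct R N R, (F.map ((altComplex a b hab).d 2 1)).hom y = x) ↔ _
  rw [altComplex_d_odd a b hab 0 (by decide), altComplex_d_even a b hab 1 (by decide)]
  have key : ∀ (c : R) (z : TensorProduct R N R), (F.map (altMul c)).hom z = c • z :=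
    fun c z => whisker_altMul (ModuleCat.of R N) c z
  let E := TensorProduct.rid R N
  constructor
  · intro h x hx
    obtain ⟨y, hy⟩ := h (E.symm x) (by
      refine (key _ _).trans ?_
      rw [← map_smul, hx, map_zero]
      rfl)
    have hy' : b • y = E.symm x := (key b y).symm.trans hy
    exact ⟨E y, by rw [← map_smul, hy', E.apply_symm_apply]⟩
  · intro h x hx
    have hx' : a • x = 0 := (key a x).symm.trans hx
    obtain ⟨y, hy⟩ := h (E x) (by rw [← map_smul, hx', map_zero])
    refine ⟨E.symm y, (key _ _).trans ?_⟩
    rw [← map_smul, hy, E.symm_apply_apply]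

end homological

section algebra

lemma zmod_div (p t : ℕ) (hp : p.Prime) (i : ℕ) (hi : i ≤ t) (x : ZMod (p ^ t))
    (hx : p ^ i • x = 0) : ∃ y, p ^ (t - i) • y = x := by
  have : NeZero (p ^ t) := ⟨pow_ne_zero _ hp.ne_zero⟩
  obtain ⟨v, rfl⟩ := ZMod.natCast_zmod_surjective x
  rw [nsmul_eq_mul, ← Nat.cast_mul, ZMod.natCast_eq_zero_iff] at hx
  have h2 : p ^ (t - i) ∣ v := by
    have : p ^ t = p ^ i * p ^ (t - i) := by rw [← pow_add]; congr 1; omega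
    rw [this] at hx
    exact Nat.dvd_of_mul_dvd_mul_left (pow_pos hp.pos i) hx
  obtain ⟨w, rfl⟩ := h2
  exact ⟨w, by simp⟩

lemma free_div (p t : ℕ) (hp : p.Prime) (i : ℕ) (hi : i ≤ t) (M : Type) [AddCommGroup M]
    [Module (ZMod (p ^ t)) M] (hM : Module.Free (ZMod (p ^ t)) M) (x : M)
    (hx : p ^ i • x = 0) : ∃ y, p ^ (t - i) • y = x := by
  classical
  let B := Module.Free.chooseBasis (ZMod (p ^ t)) M
  have h := fun z : ZMod (p ^ t) => zmod_div p t hp i hi z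
  choose! g hg using h
  let g' : ZMod (p ^ t) → ZMod (p ^ t) := fun z => if z = 0 then 0 else g z
  have hg' : ∀ z, p ^ i • z = 0 → p ^ (t - i) • g' z = z := by
    intro z hz
    by_cases h0 : z = 0
    · simp [g', h0]
    · simp only [g', if_neg h0]; exact hg z hz
  refine ⟨B.repr.symm ((B.repr x).mapRange g' (by simp [g'])), ?_⟩
  apply B.repr.injective
  rw [map_nsmul, B.repr.apply_symm_apply]
  ext k
  rw [Finsupp.smul_apply, Finsupp.mapRange_apply]
  apply hg'
  rw [← Finsupp.smul_apply, ← map_nsmul, hx]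
  simp

lemma free_of_div {S : Type} [CommRing S] (π : S) (t : ℕ) (hπ : π ^ t = 0)
    (hmax : (Ideal.span {π}).IsMaximal) (M : Type) [AddCommGroup M] [Module S M]
    (h : ∀ x : M, π • x = 0 → ∃ y : M, π ^ (t - 1) • y = x) : Module.Free S M := by
  classical
  -- killed by π^k with k<t implies divisible by π
  have hdiv : ∀ k, k < t → ∀ y : M, π ^ k • y = 0 → ∃ z : M, π • z = y := by
    intro k
    induction k with
    | zero => intro _ y hy; exact ⟨0, by simpa using hy.symm⟩
    | succ k ih =>
      intro hk y hy
      obtain ⟨z, hz⟩ := h (π ^ k • y) (by rw [smul_smul, ← pow_succ', hy])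
      obtain ⟨w, hw⟩ := ih (by omega) (y - π ^ (t - 1 - k) • z) (by
        rw [smul_sub, smul_smul, ← pow_add, ← hz,
          show k + (t - 1 - k) = t - 1 by omega, sub_self])
      refine ⟨w + π ^ (t - 1 - k - 1) • z, ?_⟩
      rw [smul_add, hw, smul_smul, ← pow_succ',
        show t - 1 - k - 1 + 1 = t - 1 - k by omega, sub_add_cancel]
  let I : Ideal S := Ideal.span {π}
  let _ : Field (S ⧸ I) := Ideal.Quotient.field I
  let Q := M ⧸ (I • ⊤ : Submodule S M)
  have hmem : ∀ x : M, x ∈ (I • ⊤ : Submodule S M) ↔ ∃ z : M, π • z = x := by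
    intro x
    rw [Submodule.ideal_span_singleton_smul, Submodule.mem_smul_pointwise_iff_exists]
    simp
  let B := Module.Basis.ofVectorSpace (S ⧸ I) Q
  choose v hv using fun i => Submodule.mkQ_surjective (I • ⊤ : Submodule S M) (B i)
  have hsm : ∀ (s : S) (q : Q), (Ideal.Quotient.mk I s) • q = s • q := by
    intro s q
    obtain ⟨m, rfl⟩ := Submodule.mkQ_surjective _ q
    rfl
  have hli : LinearIndependent S v := by
    rw [linearIndependent_iff]
    intro l hl
    have hk : ∀ k, k ≤ t → ∃ l' : _ →₀ S, l = π ^ k • l' := by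
      intro k
      induction k with
      | zero => intro _; exact ⟨l, by simp⟩
      | succ k ih =>
        intro hk
        obtain ⟨l', rfl⟩ := ih (by omega)
        rw [map_smul] at hl
        have h3 := (hmem _).2 (hdiv k (by omega) _ hl)
        rw [← Submodule.Quotient.mk_eq_zero, ← Submodule.mkQ_apply,
          Finsupp.linearCombination_apply, Finsupp.sum, map_sum] at h3
        simp only [map_smul, hv] at h3
        have h4 : ∑ i ∈ l'.support, (Ideal.Quotient.mk I (l' i)) • B i = 0 := by
          rw [← h3]; exact Finset.sum_congr rfl (fun i _ => hsm _ _)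
        have h5 := linearIndependent_iff'.1 B.linearIndependent _ _ h4
        have h6 : ∀ s : S, ∃ r : S, s ∈ I → s = π * r := by
          intro s
          by_cases hs : s ∈ I
          · obtain ⟨r, hr⟩ := Ideal.mem_span_singleton.1 hs
            exact ⟨r, fun _ => hr⟩
          · exact ⟨0, fun h => absurd h hs⟩
        choose r hr using h6
        refine ⟨Finsupp.onFinset l'.support (fun i => if l' i = 0 then 0 else r (l' i)) ?_, ?_⟩
        · intro i hi
          rw [Finsupp.mem_support_iff]
          intro h0
          exact hi (if_pos h0)
        · ext i
          simp only [Finsupp.smul_apply, Finsupp.onFinset_apply, smul_eq_mul]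
          by_cases h0 : l' i = 0
          · simp [h0]
          · rw [if_neg h0, pow_succ, mul_assoc, ← hr]
            exact Ideal.Quotient.eq_zero_iff_mem.1 (h5 i (Finsupp.mem_support_iff.2 h0))
    obtain ⟨l', rfl⟩ := hk t le_rfl
    rw [hπ, zero_smul]
  have hsp : ∀ x : M, ∃ y ∈ Submodule.span S (Set.range v), ∃ z : M, x = y + π • z := by
    intro x
    let q : Q := Submodule.mkQ _ x
    choose s hs using fun i => Ideal.Quotient.mk_surjective (B.repr q i)
    refine ⟨∑ i ∈ (B.repr q).support, s i • v i, Submodule.sum_mem _ (fun i _ =>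
      Submodule.smul_mem _ _ (Submodule.subset_span ⟨i, rfl⟩)), ?_⟩
    have : x - ∑ i ∈ (B.repr q).support, s i • v i ∈ (I • ⊤ : Submodule S M) := by
      rw [← Submodule.Quotient.mk_eq_zero, ← Submodule.mkQ_apply, map_sub, sub_eq_zero, map_sum]
      change q = _
      conv_lhs => rw [← B.linearCombination_repr q]
      rw [Finsupp.linearCombination_apply, Finsupp.sum]
      refine Finset.sum_congr rfl (fun i _ => ?_)
      rw [map_smul, hv, ← hs, hsm]
    obtain ⟨z, hz⟩ := (hmem _).1 this
    exact ⟨z, by rw [hz]; abel⟩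
  have hsp2 : ∀ k, ∀ x : M, ∃ y ∈ Submodule.span S (Set.range v), ∃ z : M, x = y + π ^ k • z := by
    intro k
    induction k with
    | zero => intro x; exact ⟨0, Submodule.zero_mem _, x, by simp⟩
    | succ k ih =>
      intro x
      obtain ⟨y, hy, z, rfl⟩ := ih x
      obtain ⟨y', hy', z', rfl⟩ := hsp z
      refine ⟨y + π ^ k • y', Submodule.add_mem _ hy (Submodule.smul_mem _ _ hy'), z', ?_⟩
      rw [smul_add, smul_smul, pow_succ, add_assoc]
  refine Module.Free.of_basis (Module.Basis.mk hli ?_)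
  intro x _
  obtain ⟨y, hy, z, rfl⟩ := hsp2 t x
  simpa [hπ] using hy

lemma zmod_max (p t : ℕ) (hp : p.Prime) (ht : 1 ≤ t) :
    (Ideal.span {(p : ZMod (p ^ t))}).IsMaximal := by
  have h0 : (Ideal.span {(p : ℤ)}).IsMaximal :=
    PrincipalIdealRing.isMaximal_of_irreducible (Nat.prime_iff_prime_int.1 hp).irreducible
  have h1 := Ideal.map_eq_top_or_isMaximal_of_surjective (Int.castRingHom (ZMod (p ^ t)))
    (ZMod.ringHom_surjective _) h0
  rw [Ideal.map_span, Set.image_singleton] at h1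
  simp only [map_natCast] at h1
  refine h1.resolve_left fun h => ?_
  rw [Ideal.span_singleton_eq_top] at h
  have h2 := h.pow t
  rw [← Nat.cast_pow, ZMod.natCast_self] at h2
  have : Fact (1 < p ^ t) := ⟨Nat.one_lt_pow (by omega) hp.one_lt⟩
  exact not_isUnit_zero h2

lemma zmod_free_of_div (p t : ℕ) (hp : p.Prime) (ht : 1 ≤ t) (M : Type) [AddCommGroup M]
    [Module (ZMod (p ^ t)) M] (h : ∀ x : M, p • x = 0 → ∃ y : M, p ^ (t - 1) • y = x) :
    Module.Free (ZMod (p ^ t)) M := by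
  refine free_of_div (p : ZMod (p ^ t)) t ?_ (zmod_max p t hp ht) M ?_
  · rw [← Nat.cast_pow, ZMod.natCast_self]
  · intro x hx
    rw [Nat.cast_smul_eq_nsmul] at hx
    obtain ⟨y, hy⟩ := h x hx
    refine ⟨y, ?_⟩
    rw [← Nat.cast_pow, Nat.cast_smul_eq_nsmul]
    exact hy

end algebra



/-- Let `p` be a prime, `t ≥ 1`, and `R` a commutative `ZMod p^t`-algebra which is free
as a `ZMod p^t`-module. An `R`-module `N` is free over `ZMod p^t` if and only if
`Tor₁^R(N, R/(p)) = 0`. -/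
theorem stmt_18 (p t : ℕ) (hp : p.Prime) (ht : 1 ≤ t)
    (R : Type) [CommRing R] [Algebra (ZMod (p ^ t)) R]
    (hRfree : Module.Free (ZMod (p ^ t)) R)
    (N : Type) [AddCommGroup N] [Module R N] :
    Module.Free (ZMod (p ^ t)) (RestrictScalars (ZMod (p ^ t)) R N) ↔
    Subsingleton (((Tor (ModuleCat R) 1).obj (ModuleCat.of R N)).obj
      (ModuleCat.of R (R ⧸ Ideal.span {(p : R)}))) := by
  have hn : ((p ^ t : ℕ) : R) = 0 := by
    have : ((p ^ t : ℕ) : R) = algebraMap (ZMod (p ^ t)) R ((p ^ t : ℕ) : ZMod (p ^ t)) := by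
      rw [map_natCast]
    rw [this, ZMod.natCast_self, map_zero]
  have hab : (p : R) * ((p ^ (t - 1) : ℕ) : R) = 0 := by
    rw [← Nat.cast_mul, ← pow_succ', Nat.sub_add_cancel ht, hn]
  rw [tor_subsingleton_iff (p : R) ((p ^ (t - 1) : ℕ) : R) hab ?_ ?_ N]
  · simp only [Nat.cast_smul_eq_nsmul]
    constructor
    · intro hN x hx
      exact @free_div p t hp 1 ht (RestrictScalars (ZMod (p ^ t)) R N) (inferInstanceAs (AddCommGroup N))
        (RestrictScalars.module (ZMod (p ^ t)) R N) hN x (by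
        rw [pow_one]; exact hx)
    · intro h
      exact @zmod_free_of_div p t hp ht (RestrictScalars (ZMod (p ^ t)) R N)
        (inferInstanceAs (AddCommGroup N)) (RestrictScalars.module (ZMod (p ^ t)) R N) h
  · intro x hx
    obtain ⟨y, hy⟩ := free_div p t hp 1 ht R hRfree x (by
      rw [pow_one, nsmul_eq_mul, hx])
    exact ⟨y, by rw [← nsmul_eq_mul, hy]⟩
  · intro x hx
    obtain ⟨y, hy⟩ := free_div p t hp (t - 1) (by omega) R hRfree x (by
      rw [nsmul_eq_mul, hx])
    refine ⟨y, ?_⟩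
    rw [show t - (t - 1) = 1 by omega, pow_one, nsmul_eq_mul] at hy
    exact hy
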